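/- Let A be a set of n lines in ℝ² in general position, and let r₁ and r₂ be two rays emanating from a common point p. The broken line r₁ ∪ r₂ splits ℝ² into two closed regions C₁ and C₂ (whose union is ℝ², whose interiors are disjoint, and whose common boundary is r₁ ∪ r₂). Then μ_A(C₁)·μ_A(C₂) ≥ 2n/3. -/

import Mathlib

open scoped Classical

/-- A line in the plane: the solution set of `a*x + b*y = c` with `(a,b) ≠ (0,0)`. -/
def IsLine (L : Set (ℝ × ℝ)) : Prop :=
  ∃ a b c : ℝ, (a, b) ≠ (0, 0) ∧ L = {p : ℝ × ℝ | a * p.1 + b * p.2 = c}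

/-- The incidence set of a finite family of lines: all pairwise intersection points. -/
def incSet (L : Finset (Set (ℝ × ℝ))) : Set (ℝ × ℝ) :=
  {p | ∃ ℓ₁ ∈ L, ∃ ℓ₂ ∈ L, ℓ₁ ≠ ℓ₂ ∧ p ∈ ℓ₁ ∧ p ∈ ℓ₂}

/-- Two lines are non-parallel if they meet in exactly one point. -/
def NotParallel (L₁ L₂ : Set (ℝ × ℝ)) : Prop := ∃! p : ℝ × ℝ, p ∈ L₁ ∩ L₂

/-- No two lines of the family are parallel. -/
def PairwiseNonParallel (L : Finset (Set (ℝ × ℝ))) : Prop :=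
  ∀ ℓ₁ ∈ L, ∀ ℓ₂ ∈ L, ℓ₁ ≠ ℓ₂ → NotParallel ℓ₁ ℓ₂

/-- A family of lines is in general position: no two parallel, no three concurrent, and any
three collinear points of the incidence set lie on a common line of the family. -/
def GenPos (L : Finset (Set (ℝ × ℝ))) : Prop :=
  PairwiseNonParallel L ∧
  (∀ ℓ₁ ∈ L, ∀ ℓ₂ ∈ L, ∀ ℓ₃ ∈ L, ℓ₁ ≠ ℓ₂ → ℓ₁ ≠ ℓ₃ → ℓ₂ ≠ ℓ₃ →
    ¬ ∃ p : ℝ × ℝ, p ∈ ℓ₁ ∧ p ∈ ℓ₂ ∧ p ∈ ℓ₃) ∧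
  (∀ p q s : ℝ × ℝ, p ∈ incSet L → q ∈ incSet L → s ∈ incSet L →
    p ≠ q → p ≠ s → q ≠ s → Collinear ℝ ({p, q, s} : Set (ℝ × ℝ)) →
    ∃ ℓ ∈ L, p ∈ ℓ ∧ q ∈ ℓ ∧ s ∈ ℓ)

/-- `mu A K` is the largest cardinality of a subset of `A` whose incidence set lies in `K`. -/
noncomputable def mu (A : Finset (Set (ℝ × ℝ))) (K : Set (ℝ × ℝ)) : ℕ :=
  (A.powerset.filter (fun A' => incSet A' ⊆ K)).sup Finset.card

/-- A convex partition of the plane into `r` parts: closed convex sets covering `ℝ²`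
with pairwise disjoint interiors. -/
def ConvexPartition {r : ℕ} (C : Fin r → Set (ℝ × ℝ)) : Prop :=
  (∀ j, IsClosed (C j)) ∧ (∀ j, Convex ℝ (C j)) ∧
  (⋃ j, C j) = Set.univ ∧
  Pairwise fun i j => interior (C i) ∩ interior (C j) = ∅

/-- The ray from `p` in direction `v`. -/
def ray (p v : ℝ × ℝ) : Set (ℝ × ℝ) := {q | ∃ t : ℝ, 0 ≤ t ∧ q = p + t • v}

lemma card_le_mu {A A' : Finset (Set (ℝ × ℝ))} {K : Set (ℝ × ℝ)} (h : A' ⊆ A)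
    (hK : incSet A' ⊆ K) : A'.card ≤ mu A K :=
  Finset.le_sup (f := Finset.card) (by simp [h, hK])

lemma one_le_mu {A : Finset (Set (ℝ × ℝ))} (hA : A.Nonempty) (K : Set (ℝ × ℝ)) :
    1 ≤ mu A K := by
  obtain ⟨ℓ, hℓ⟩ := hA
  refine card_le_mu (A' := {ℓ}) (by simpa using hℓ) ?_
  rintro q ⟨a, ha, b, hb, hab, -⟩
  simp only [Finset.mem_singleton] at ha hb
  exact absurd (ha.trans hb.symm) hab

/-- The strict order on `α` pulled back from the product order along `(f, g)`. -/
def ProdLT {α : Type*} (f g : α → ℝ) (x y : α) : Prop :=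
  f x ≤ f y ∧ g x ≤ g y ∧ f x + g x < f y + g y

/-- A set with chains of size at most `k` and antichains of size at most `m` has at most
`m * k` elements. -/
lemma card_le_of_chain_of_antichain {α : Type*} (f g : α → ℝ) (m k : ℕ) (U : Finset α)
    (hc : ∀ c ⊆ U, (∀ x ∈ c, ∀ y ∈ c, x ≠ y → ProdLT f g x y ∨ ProdLT f g y x) → c.card ≤ k)
    (ha : ∀ a ⊆ U, (∀ x ∈ a, ∀ y ∈ a, ¬ ProdLT f g x y) → a.card ≤ m) :
    U.card ≤ m * k := by
  induction k generalizing U with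
  | zero =>
    rcases U.eq_empty_or_nonempty with rfl | ⟨x, hx⟩
    · simp
    · have := hc {x} (by simpa using hx) (by simp)
      simp at this
  | succ k ih =>
    have hsplit := Finset.card_filter_add_card_filter_not (s := U)
      (fun x => ∀ y ∈ U, ¬ ProdLT f g y x)
    have hmin : (U.filter (fun x => ∀ y ∈ U, ¬ ProdLT f g y x)).card ≤ m := by
      refine ha _ (Finset.filter_subset _ _) fun x hx y hy => ?_
      exact (Finset.mem_filter.1 hy).2 x (Finset.mem_filter.1 hx).1
    have hrest : (U.filter (fun x => ¬ ∀ y ∈ U, ¬ ProdLT f g y x)).card ≤ m * k := by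
      refine ih _ (fun c hcU hchain => ?_)
        (fun a haU => ha a (haU.trans (Finset.filter_subset _ _)))
      rcases c.eq_empty_or_nonempty with rfl | hne
      · simp
      obtain ⟨x, hx, hxmin⟩ := Finset.exists_min_image c (fun z => f z + g z) hne
      have hxU := (Finset.mem_filter.1 (hcU hx)).2
      push Not at hxU
      obtain ⟨y, hyU, hyx⟩ := hxU
      have hbelow : ∀ z ∈ c, ProdLT f g y z := by
        intro z hz
        by_cases hzx : z = x
        · exact hzx ▸ hyx
        rcases hchain z hz x hx hzx with h | h
        · exact absurd h.2.2 (not_lt.2 (hxmin z hz))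
        · exact ⟨hyx.1.trans h.1, hyx.2.1.trans h.2.1, hyx.2.2.trans h.2.2⟩
      have hyc : y ∉ c := fun h => lt_irrefl _ (hbelow y h).2.2
      have := hc (insert y c)
        (Finset.insert_subset hyU (hcU.trans (Finset.filter_subset _ _))) (by
          intro u hu v hv huv
          rw [Finset.mem_insert] at hu hv
          rcases hu with hu | hu <;> rcases hv with hv | hv
          · exact absurd (hu.trans hv.symm) huv
          · exact Or.inl (hu ▸ hbelow v hv)
          · exact Or.inr (hv ▸ hbelow u hu)
          · exact hchain u hu v hv huv)
      rw [Finset.card_insert_of_notMem hyc] at this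
      omega
    rw [Nat.mul_succ]
    omega

/-- Erdős–Szekeres type bound: concordant pairs of `U` meet in `D`, discordant pairs meet in
`C`, and the lines of `N` lie in `D`. -/
lemma card_add_card_le_mu_mul_mu {A U N : Finset (Set (ℝ × ℝ))} {C D : Set (ℝ × ℝ)}
    (hU : U ⊆ A) (hN : N ⊆ A) (hUN : Disjoint U N) (f g : Set (ℝ × ℝ) → ℝ)
    (hconc : ∀ ℓ ∈ U, ∀ ℓ' ∈ U, ℓ ≠ ℓ' → f ℓ ≤ f ℓ' → g ℓ ≤ g ℓ' → ℓ ∩ ℓ' ⊆ D)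
    (hdisc : ∀ ℓ ∈ U, ∀ ℓ' ∈ U, ℓ ≠ ℓ' → f ℓ ≤ f ℓ' → g ℓ' ≤ g ℓ → ℓ ∩ ℓ' ⊆ C)
    (hND : ∀ ℓ ∈ N, ℓ ⊆ D) :
    U.card + N.card ≤ mu A C * mu A D := by
  set S := U.powerset.filter
    (fun c => ∀ x ∈ c, ∀ y ∈ c, x ≠ y → ProdLT f g x y ∨ ProdLT f g y x) with hS
  have hSne : S.Nonempty := ⟨∅, by simp [hS]⟩
  obtain ⟨c, hcS, hcmax⟩ := Finset.exists_max_image S Finset.card hSne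
  simp only [hS, Finset.mem_filter, Finset.mem_powerset] at hcS hcmax
  have hmain : U.card ≤ mu A C * c.card := by
    refine card_le_of_chain_of_antichain f g _ _ U (fun d hd hd' => hcmax d ⟨hd, hd'⟩) ?_
    intro a haU ha
    refine card_le_mu (haU.trans hU) ?_
    have key : ∀ x ∈ a, ∀ y ∈ a, x ≠ y → f x ≤ f y → x ∩ y ⊆ C := by
      intro x hx y hy hxy hf
      refine hdisc x (haU hx) y (haU hy) hxy hf ?_
      by_contra hg
      push Not at hg
      exact ha x hx y hy ⟨hf, hg.le, by linarith⟩
    rintro q ⟨x, hx, y, hy, hxy, hqx, hqy⟩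
    rcases le_total (f x) (f y) with h | h
    · exact key x hx y hy hxy h ⟨hqx, hqy⟩
    · exact key y hy x hx hxy.symm h ⟨hqy, hqx⟩
  have hcN : c.card + N.card ≤ mu A D := by
    rw [← Finset.card_union_of_disjoint (Finset.disjoint_of_subset_left hcS.1 hUN)]
    refine card_le_mu (Finset.union_subset (hcS.1.trans hU) hN) ?_
    rintro q ⟨x, hx, y, hy, hxy, hqx, hqy⟩
    rcases Finset.mem_union.1 hx with hx | hx
    · rcases Finset.mem_union.1 hy with hy | hy
      · rcases hcS.2 x hx y hy hxy with h | h
        · exact hconc x (hcS.1 hx) y (hcS.1 hy) hxy h.1 h.2.1 ⟨hqx, hqy⟩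
        · exact hconc y (hcS.1 hy) x (hcS.1 hx) hxy.symm h.1 h.2.1 ⟨hqy, hqx⟩
      · exact hND y hy hqy
    · exact hND x hx hqx
  rcases A.eq_empty_or_nonempty with rfl | hA
  · rw [Finset.subset_empty.1 hU, Finset.subset_empty.1 hN]; simp
  have h1 := one_le_mu hA C
  calc U.card + N.card ≤ mu A C * c.card + mu A C * N.card := by nlinarith
    _ = mu A C * (c.card + N.card) := by ring
    _ ≤ _ := Nat.mul_le_mul_left _ hcN

/-- `ℓ` is a line in the coordinates given by `E`. -/
def IsLineIn (E : ℝ × ℝ ≃ ℝ × ℝ) (ℓ : Set (ℝ × ℝ)) : Prop :=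
  ∃ a b c : ℝ, (a, b) ≠ (0, 0) ∧ ∀ x y, E (x, y) ∈ ℓ ↔ a * x + b * y = c

/-- `ℓ` meets the nonnegative first coordinate axis. -/
def MeetsAxis (E : ℝ × ℝ ≃ ℝ × ℝ) (ℓ : Set (ℝ × ℝ)) : Prop :=
  ∃ a : ℝ, 0 ≤ a ∧ E (a, 0) ∈ ℓ

/-- `ℓ` meets the open positive quadrant. -/
def MeetsQuadrant (E : ℝ × ℝ ≃ ℝ × ℝ) (ℓ : Set (ℝ × ℝ)) : Prop :=
  ∃ x y : ℝ, 0 < x ∧ 0 < y ∧ E (x, y) ∈ ℓ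

/-- The coordinates `E` with the two axes exchanged. -/
def swapCoord (E : ℝ × ℝ ≃ ℝ × ℝ) : ℝ × ℝ ≃ ℝ × ℝ := (Equiv.prodComm ℝ ℝ).trans E

@[simp] lemma swapCoord_apply (E : ℝ × ℝ ≃ ℝ × ℝ) (x y : ℝ) :
    swapCoord E (x, y) = E (y, x) := rfl

lemma IsLineIn.swap {E : ℝ × ℝ ≃ ℝ × ℝ} {ℓ : Set (ℝ × ℝ)} (h : IsLineIn E ℓ) :
    IsLineIn (swapCoord E) ℓ := by
  obtain ⟨a, b, c, hab, h⟩ := h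
  refine ⟨b, a, c, fun h0 => hab ?_, fun x y => ?_⟩
  · simp only [Prod.mk.injEq] at h0 ⊢
    exact h0.symm
  · rw [swapCoord_apply, h, add_comm]

lemma MeetsQuadrant.swap_iff {E : ℝ × ℝ ≃ ℝ × ℝ} {ℓ : Set (ℝ × ℝ)} :
    MeetsQuadrant (swapCoord E) ℓ ↔ MeetsQuadrant E ℓ := by
  constructor <;> rintro ⟨x, y, hx, hy, h⟩ <;> exact ⟨y, x, hy, hx, h⟩

lemma exists_param_of_meetsAxis {E : ℝ × ℝ ≃ ℝ × ℝ} {ℓ : Set (ℝ × ℝ)} (h : IsLineIn E ℓ)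
    (hq : MeetsQuadrant E ℓ) (hx : MeetsAxis E ℓ) :
    ∃ a w : ℝ, 0 ≤ a ∧ ∀ x y, E (x, y) ∈ ℓ ↔ x = a + y * w := by
  obtain ⟨α, β, γ, hab, h⟩ := h
  obtain ⟨s, t, hs, ht, hst⟩ := hq
  obtain ⟨a, ha, hal⟩ := hx
  rw [h] at hst hal
  have hα : α ≠ 0 := by
    rintro rfl
    have : β * t = 0 := by linarith
    rcases mul_eq_zero.1 this with rfl | h0
    · exact hab rfl
    · exact ht.ne' h0
  refine ⟨a, -β / α, ha, fun x y => ?_⟩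
  rw [h]
  field_simp
  constructor <;> intro h' <;> linarith

lemma meetsAxis_or {E : ℝ × ℝ ≃ ℝ × ℝ} {ℓ : Set (ℝ × ℝ)} (h : IsLineIn E ℓ)
    (hq : MeetsQuadrant E ℓ) : MeetsAxis E ℓ ∨ MeetsAxis (swapCoord E) ℓ := by
  obtain ⟨α, β, γ, hab, h⟩ := h
  obtain ⟨s, t, hs, ht, hst⟩ := hq
  rw [h] at hst
  by_cases h1 : 0 ≤ α * γ ∧ α ≠ 0
  · refine Or.inl ⟨γ / α, ?_, ?_⟩
    · rw [← mul_div_mul_left γ α h1.2]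
      exact div_nonneg h1.1 (mul_self_nonneg _)
    · rw [h]; field_simp [h1.2]; ring
  by_cases h2 : 0 ≤ β * γ ∧ β ≠ 0
  · refine Or.inr ⟨γ / β, ?_, ?_⟩
    · rw [← mul_div_mul_left γ β h2.2]
      exact div_nonneg h2.1 (mul_self_nonneg _)
    · rw [swapCoord_apply, h]; field_simp [h2.2]; ring
  exfalso
  have key : ∀ z : ℝ, ¬ (0 ≤ z * γ ∧ z ≠ 0) → z * γ ≤ 0 ∧ (z * γ = 0 → z = 0) := by
    intro z hz
    by_cases hz0 : z = 0
    · simp [hz0]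
    · have : z * γ < 0 := by
        by_contra h0
        exact hz ⟨not_lt.1 h0, hz0⟩
      exact ⟨this.le, fun h => absurd h this.ne⟩
  obtain ⟨ha, ha'⟩ := key α h1
  obtain ⟨hb, hb'⟩ := key β h2
  have hsum : (α * γ) * s + (β * γ) * t = γ * γ := by rw [← hst]; ring
  have h3 := mul_nonneg (neg_nonneg.2 ha) hs.le
  have h4 := mul_nonneg (neg_nonneg.2 hb) ht.le
  have h5 : γ = 0 := mul_self_eq_zero.1 (by nlinarith [mul_self_nonneg γ])
  subst h5
  exact hab (by rw [ha' (by ring), hb' (by ring)])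

lemma exists_param_of_not_meetsAxis {E : ℝ × ℝ ≃ ℝ × ℝ} {ℓ : Set (ℝ × ℝ)}
    (h : IsLineIn E ℓ) (hq : MeetsQuadrant E ℓ) (hx : MeetsAxis E ℓ)
    (hy : ¬ MeetsAxis (swapCoord E) ℓ) :
    ∃ a w : ℝ, 0 ≤ a ∧ 0 ≤ w ∧ ∀ x y, E (x, y) ∈ ℓ ↔ x = a + y * w := by
  obtain ⟨a, w, ha, h'⟩ := exists_param_of_meetsAxis h hq hx
  refine ⟨a, w, ha, ?_, h'⟩
  by_contra hw
  push Not at hw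
  refine hy ⟨a / -w, div_nonneg ha (by linarith), ?_⟩
  rw [swapCoord_apply, h', div_neg, neg_mul, div_mul_cancel₀ a hw.ne]
  ring

/-- Every line meeting the open quadrant and exactly one of its sides is given by a point of the
boundary of the quadrant and a direction in the quadrant. -/
lemma exists_param_of_xor {E : ℝ × ℝ ≃ ℝ × ℝ} {ℓ : Set (ℝ × ℝ)} (h : IsLineIn E ℓ)
    (hq : MeetsQuadrant E ℓ) (hne : ¬ (MeetsAxis E ℓ ∧ MeetsAxis (swapCoord E) ℓ)) :
    ∃ u d : ℝ, 0 ≤ d ∧ d ≤ 1 ∧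
      ∀ x y, E (x, y) ∈ ℓ ↔ (1 - d) * (x - max u 0) = d * (y - max (-u) 0) := by
  by_cases hx : MeetsAxis E ℓ
  · obtain ⟨a, w, ha, hw, h'⟩ :=
      exists_param_of_not_meetsAxis h hq hx fun hy => hne ⟨hx, hy⟩
    have hw1 : 0 < 1 + w := by linarith
    refine ⟨a, w / (1 + w), by positivity, (div_le_one hw1).2 (by linarith), fun x y => ?_⟩
    rw [h', max_eq_left ha, max_eq_right (by linarith)]
    field_simp
    constructor <;> intro h0 <;> linarith
  · have hy := (meetsAxis_or h hq).resolve_left hx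
    obtain ⟨a, w, ha, hw, h'⟩ := exists_param_of_not_meetsAxis h.swap
      (MeetsQuadrant.swap_iff.2 hq) hy fun hy => hx hy
    have hw1 : 0 < 1 + w := by linarith
    refine ⟨-a, 1 / (1 + w), by positivity, (div_le_one hw1).2 (by linarith), fun x y => ?_⟩
    rw [← swapCoord_apply, h', neg_neg, max_eq_left ha, max_eq_right (by linarith)]
    field_simp
    constructor <;> intro h0 <;> linarith

section Quadrant

variable {E : ℝ × ℝ ≃ ℝ × ℝ} {A : Finset (Set (ℝ × ℝ))} {C D : Set (ℝ × ℝ)}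

lemma subset_of_not_meetsQuadrant (hD : ∀ x y, x ≤ 0 ∨ y ≤ 0 → E (x, y) ∈ D)
    {ℓ : Set (ℝ × ℝ)} (h : ¬ MeetsQuadrant E ℓ) : ℓ ⊆ D := by
  intro q hq
  obtain ⟨⟨x, y⟩, rfl⟩ := E.surjective q
  refine hD x y ?_
  by_contra! hxy
  exact h ⟨x, y, hxy.1, hxy.2, hq⟩

lemma ext_coord {ℓ ℓ' : Set (ℝ × ℝ)} (h : ∀ x y, E (x, y) ∈ ℓ ↔ E (x, y) ∈ ℓ') : ℓ = ℓ' := by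
  ext q
  obtain ⟨⟨x, y⟩, rfl⟩ := E.surjective q
  exact h x y

/-- The bound for the lines meeting a fixed side of the quadrant or missing its interior. -/
lemma card_meetsAxis_le (hA : ∀ ℓ ∈ A, IsLineIn E ℓ)
    (hC : ∀ x y, 0 ≤ x → 0 ≤ y → E (x, y) ∈ C) (hD : ∀ x y, x ≤ 0 ∨ y ≤ 0 → E (x, y) ∈ D) :
    (A.filter fun ℓ => MeetsQuadrant E ℓ ∧ MeetsAxis E ℓ).card
      + (A.filter fun ℓ => ¬ MeetsQuadrant E ℓ).card ≤ mu A C * mu A D := by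
  have hex : ∀ ℓ : Set (ℝ × ℝ), ∃ a w : ℝ,
      ℓ ∈ (A.filter fun ℓ => MeetsQuadrant E ℓ ∧ MeetsAxis E ℓ) →
      0 ≤ a ∧ ∀ x y, E (x, y) ∈ ℓ ↔ x = a + y * w := by
    intro ℓ
    by_cases hℓ : ℓ ∈ (A.filter fun ℓ => MeetsQuadrant E ℓ ∧ MeetsAxis E ℓ)
    · have h := Finset.mem_filter.1 hℓ
      obtain ⟨a, w, h⟩ := exists_param_of_meetsAxis (hA ℓ h.1) h.2.1 h.2.2
      exact ⟨a, w, fun _ => h⟩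
    · exact ⟨0, 0, fun h => absurd h hℓ⟩
  choose a w haw using hex
  refine card_add_card_le_mu_mul_mu (Finset.filter_subset _ _) (Finset.filter_subset _ _)
    (Finset.disjoint_filter.2 fun _ _ h h' => h' h.1) a
    (fun ℓ => if w ℓ < 0 then w ℓ / (a ℓ - w ℓ) else w ℓ) ?_ ?_
    (fun ℓ hℓ => subset_of_not_meetsQuadrant hD (Finset.mem_filter.1 hℓ).2)
  · rintro ℓ hℓ ℓ' hℓ' hne haa hg q ⟨hq, hq'⟩
    obtain ⟨ha, h⟩ := haw ℓ hℓ
    obtain ⟨ha', h'⟩ := haw ℓ' hℓ'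
    obtain ⟨⟨x, y⟩, rfl⟩ := E.surjective q
    refine hD x y ?_
    rw [h] at hq
    rw [h'] at hq'
    have hww : w ℓ ≠ w ℓ' := by
      intro hw
      refine hne (ext_coord (E := E) fun u v => ?_)
      rw [h, h', hw, show a ℓ = a ℓ' by rw [hw] at hq; linarith]
    by_contra! hxy
    have hlt : w ℓ' < w ℓ := by
      by_contra hle
      have : w ℓ < w ℓ' := lt_of_le_of_ne (not_lt.1 hle) hww
      nlinarith
    split_ifs at hg with h1 h2 h2
    · rw [div_le_div_iff₀ (by linarith) (by linarith)] at hg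
      have : x * (w ℓ - w ℓ') = a ℓ' * w ℓ - a ℓ * w ℓ' := by
        linear_combination (-w ℓ') * hq + w ℓ * hq'
      nlinarith
    · linarith
    · have : w ℓ' / (a ℓ' - w ℓ') < 0 := div_neg_of_neg_of_pos h2 (by linarith)
      linarith
    · linarith
  · rintro ℓ hℓ ℓ' hℓ' hne haa hg q ⟨hq, hq'⟩
    obtain ⟨ha, h⟩ := haw ℓ hℓ
    obtain ⟨ha', h'⟩ := haw ℓ' hℓ'
    obtain ⟨⟨x, y⟩, rfl⟩ := E.surjective q
    rw [h] at hq
    rw [h'] at hq'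
    have hww : w ℓ ≠ w ℓ' := by
      intro hw
      refine hne (ext_coord (E := E) fun u v => ?_)
      rw [h, h', hw, show a ℓ = a ℓ' by rw [hw] at hq; linarith]
    have hy : y * (w ℓ - w ℓ') = a ℓ' - a ℓ := by linarith
    have hy0 : w ℓ' < w ℓ → 0 ≤ y := by
      intro hlt
      by_contra! hy'
      nlinarith
    split_ifs at hg with h1 h2 h2
    · rw [div_le_div_iff₀ (by linarith) (by linarith)] at hg
      have hx : x * (w ℓ - w ℓ') = a ℓ' * w ℓ - a ℓ * w ℓ' := by
        linear_combination (-w ℓ') * hq + w ℓ * hq'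
      rcases ha.eq_or_lt with ha0 | ha0
      · have ha1 : a ℓ' = 0 := by
          rw [← ha0] at hg
          nlinarith
        have hy1 : y = 0 := by
          rw [ha1, ← ha0, sub_zero] at hy
          exact (mul_eq_zero.1 hy).resolve_right (sub_ne_zero.2 hww)
        exact hC x y (by rw [hq, hy1, ← ha0]; simp) hy1.ge
      · have hlt : w ℓ' < w ℓ := by
          refine lt_of_le_of_ne ?_ hww.symm
          by_contra! hlt
          nlinarith
        refine hC x y ?_ (hy0 hlt)
        by_contra! hx0
        nlinarith
    · have := hy0 (by linarith)
      exact hC x y (by rw [hq]; nlinarith) this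
    · have : w ℓ / (a ℓ - w ℓ) < 0 := div_neg_of_neg_of_pos h2 (by linarith)
      linarith
    · have := hy0 (lt_of_le_of_ne hg hww.symm)
      exact hC x y (by rw [hq]; nlinarith) this

/-- The bound for the lines not meeting both sides of the quadrant or missing its interior. -/
lemma card_not_meetsAxis_and_le (hA : ∀ ℓ ∈ A, IsLineIn E ℓ)
    (hC : ∀ x y, 0 ≤ x → 0 ≤ y → E (x, y) ∈ C) (hD : ∀ x y, x ≤ 0 ∨ y ≤ 0 → E (x, y) ∈ D) :
    (A.filter fun ℓ => MeetsQuadrant E ℓ ∧ ¬ (MeetsAxis E ℓ ∧ MeetsAxis (swapCoord E) ℓ)).card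
      + (A.filter fun ℓ => ¬ MeetsQuadrant E ℓ).card ≤ mu A C * mu A D := by
  have hex : ∀ ℓ : Set (ℝ × ℝ), ∃ u d : ℝ,
      ℓ ∈ (A.filter fun ℓ =>
        MeetsQuadrant E ℓ ∧ ¬ (MeetsAxis E ℓ ∧ MeetsAxis (swapCoord E) ℓ)) →
      0 ≤ d ∧ d ≤ 1 ∧
        ∀ x y, E (x, y) ∈ ℓ ↔ (1 - d) * (x - max u 0) = d * (y - max (-u) 0) := by
    intro ℓ
    by_cases hℓ : ℓ ∈ (A.filter fun ℓ =>
        MeetsQuadrant E ℓ ∧ ¬ (MeetsAxis E ℓ ∧ MeetsAxis (swapCoord E) ℓ))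
    · have h := Finset.mem_filter.1 hℓ
      obtain ⟨u, d, h⟩ := exists_param_of_xor (hA ℓ h.1) h.2.1 h.2.2
      exact ⟨u, d, fun _ => h⟩
    · exact ⟨0, 0, fun h => absurd h hℓ⟩
  choose u d hud using hex
  have hpos : ∀ v : ℝ, 0 ≤ max v 0 := fun v => le_max_right _ _
  have hzero : ∀ v : ℝ, max v 0 = 0 ∨ max (-v) 0 = 0 := by
    intro v
    rcases le_total v 0 with h | h
    · exact Or.inl (max_eq_right h)
    · exact Or.inr (max_eq_right (by linarith))
  -- The sign of the position of a point along a line decides its region.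
  have key : ∀ ℓ ∈ (A.filter fun ℓ =>
        MeetsQuadrant E ℓ ∧ ¬ (MeetsAxis E ℓ ∧ MeetsAxis (swapCoord E) ℓ)),
      ∀ x y, E (x, y) ∈ ℓ → ∃ l, x = max (u ℓ) 0 + l * d ℓ ∧
        y = max (-u ℓ) 0 + l * (1 - d ℓ) ∧ (0 ≤ l → E (x, y) ∈ C) ∧ (l ≤ 0 → E (x, y) ∈ D) := by
    intro ℓ hℓ x y hxy
    obtain ⟨hd0, hd1, h⟩ := hud ℓ hℓ
    rw [h] at hxy
    have hx : x = max (u ℓ) 0 + ((x - max (u ℓ) 0) + (y - max (-u ℓ) 0)) * d ℓ := by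
      linear_combination hxy
    have hy : y = max (-u ℓ) 0 + ((x - max (u ℓ) 0) + (y - max (-u ℓ) 0)) * (1 - d ℓ) := by
      linear_combination -hxy
    generalize (x - max (u ℓ) 0) + (y - max (-u ℓ) 0) = l at hx hy
    have h1d : 0 ≤ 1 - d ℓ := by linarith
    refine ⟨l, hx, hy, fun hl => hC x y ?_ ?_, fun hl => hD x y ?_⟩
    · rw [hx]; exact add_nonneg (hpos _) (mul_nonneg hl hd0)
    · rw [hy]; exact add_nonneg (hpos _) (mul_nonneg hl h1d)
    · rcases hzero (u ℓ) with h0 | h0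
      · left; rw [hx, h0]; nlinarith
      · right; rw [hy, h0]; nlinarith
  have hsep : ∀ ℓ ∈ (A.filter fun ℓ =>
        MeetsQuadrant E ℓ ∧ ¬ (MeetsAxis E ℓ ∧ MeetsAxis (swapCoord E) ℓ)),
      ∀ ℓ' ∈ (A.filter fun ℓ =>
        MeetsQuadrant E ℓ ∧ ¬ (MeetsAxis E ℓ ∧ MeetsAxis (swapCoord E) ℓ)),
      ℓ ≠ ℓ' → ∀ x y, E (x, y) ∈ ℓ → E (x, y) ∈ ℓ' → d ℓ ≠ d ℓ' := by
    intro ℓ hℓ ℓ' hℓ' hne x y hq hq' hdd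
    obtain ⟨-, -, h⟩ := hud ℓ hℓ
    obtain ⟨-, -, h'⟩ := hud ℓ' hℓ'
    refine hne (ext_coord (E := E) fun v z => ?_)
    rw [h] at hq ⊢
    rw [h'] at hq' ⊢
    rw [hdd] at hq ⊢
    constructor <;> intro h0 <;> linarith
  have hcmp : ∀ ℓ ∈ (A.filter fun ℓ =>
        MeetsQuadrant E ℓ ∧ ¬ (MeetsAxis E ℓ ∧ MeetsAxis (swapCoord E) ℓ)),
      ∀ ℓ' ∈ (A.filter fun ℓ =>
        MeetsQuadrant E ℓ ∧ ¬ (MeetsAxis E ℓ ∧ MeetsAxis (swapCoord E) ℓ)),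
      u ℓ ≤ u ℓ' → ∀ l l' : ℝ, max (u ℓ) 0 + l * d ℓ = max (u ℓ') 0 + l' * d ℓ' →
      max (-u ℓ) 0 + l * (1 - d ℓ) = max (-u ℓ') 0 + l' * (1 - d ℓ') →
      0 ≤ l * (d ℓ - d ℓ') := by
    intro ℓ hℓ ℓ' hℓ' hu l l' h1 h2
    obtain ⟨hd0, hd1, -⟩ := hud ℓ' hℓ'
    have e1 : max (u ℓ) 0 ≤ max (u ℓ') 0 := max_le_max_right _ hu
    have e2 : max (-u ℓ') 0 ≤ max (-u ℓ) 0 := max_le_max_right _ (by linarith)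
    have e3 := mul_le_mul_of_nonneg_right (show l' * d ℓ' ≤ l * d ℓ by linarith)
      (show 0 ≤ 1 - d ℓ' by linarith)
    have e4 := mul_le_mul_of_nonneg_right
      (show l * (1 - d ℓ) ≤ l' * (1 - d ℓ') by linarith) hd0
    linarith
  refine card_add_card_le_mu_mul_mu (Finset.filter_subset _ _) (Finset.filter_subset _ _)
    (Finset.disjoint_filter.2 fun _ _ h h' => h' h.1) u d ?_ ?_
    (fun ℓ hℓ => subset_of_not_meetsQuadrant hD (Finset.mem_filter.1 hℓ).2)
  · rintro ℓ hℓ ℓ' hℓ' hne hu hd q ⟨hq, hq'⟩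
    obtain ⟨⟨x, y⟩, rfl⟩ := E.surjective q
    have hdd := lt_of_le_of_ne hd (hsep ℓ hℓ ℓ' hℓ' hne x y hq hq')
    obtain ⟨l, hx, hy, -, hlD⟩ := key ℓ hℓ x y hq
    obtain ⟨l', hx', hy', -, -⟩ := key ℓ' hℓ' x y hq'
    have := hcmp ℓ hℓ ℓ' hℓ' hu l l' (hx.symm.trans hx') (hy.symm.trans hy')
    refine hlD ?_
    by_contra! hl
    nlinarith
  · rintro ℓ hℓ ℓ' hℓ' hne hu hd q ⟨hq, hq'⟩
    obtain ⟨⟨x, y⟩, rfl⟩ := E.surjective q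
    have hdd := lt_of_le_of_ne hd (hsep ℓ hℓ ℓ' hℓ' hne x y hq hq').symm
    obtain ⟨l, hx, hy, hlC, -⟩ := key ℓ hℓ x y hq
    obtain ⟨l', hx', hy', -, -⟩ := key ℓ' hℓ' x y hq'
    have := hcmp ℓ hℓ ℓ' hℓ' hu l l' (hx.symm.trans hx') (hy.symm.trans hy')
    refine hlC ?_
    by_contra! hl
    nlinarith

/-- The broken line bound in coordinates in which one region is the closed quadrant. -/
lemma two_mul_card_le_of_quadrant (hA : ∀ ℓ ∈ A, IsLineIn E ℓ)
    (hC : ∀ x y, 0 ≤ x → 0 ≤ y → E (x, y) ∈ C) (hD : ∀ x y, x ≤ 0 ∨ y ≤ 0 → E (x, y) ∈ D) :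
    2 * A.card ≤ 3 * (mu A C * mu A D) := by
  have h1 := card_meetsAxis_le hA hC hD
  have h2 := card_meetsAxis_le (E := swapCoord E) (fun ℓ hℓ => (hA ℓ hℓ).swap)
    (fun x y hx hy => hC y x hy hx) (fun x y h => hD y x h.symm)
  have h3 := card_not_meetsAxis_and_le hA hC hD
  simp only [MeetsQuadrant.swap_iff] at h2
  have hsum : 2 * (A.filter fun ℓ => MeetsQuadrant E ℓ).card
      ≤ (A.filter fun ℓ => MeetsQuadrant E ℓ ∧ MeetsAxis E ℓ).card
      + (A.filter fun ℓ => MeetsQuadrant E ℓ ∧ MeetsAxis (swapCoord E) ℓ).card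
      + (A.filter fun ℓ =>
        MeetsQuadrant E ℓ ∧ ¬ (MeetsAxis E ℓ ∧ MeetsAxis (swapCoord E) ℓ)).card := by
    simp only [Finset.card_filter, Finset.mul_sum, ← Finset.sum_add_distrib]
    refine Finset.sum_le_sum fun ℓ hℓ => ?_
    have := meetsAxis_or (hA ℓ hℓ)
    by_cases hq : MeetsQuadrant E ℓ <;> by_cases hx : MeetsAxis E ℓ <;>
      by_cases hy : MeetsAxis (swapCoord E) ℓ <;> simp_all
  have hsplit := Finset.card_filter_add_card_filter_not (s := A) (fun ℓ => MeetsQuadrant E ℓ)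
  omega

/-- The bound when the regions are half-planes and the lines parallel to the boundary lie in
one of them. -/
lemma card_le_of_halfPlane (hA : ∀ ℓ ∈ A, IsLineIn E ℓ)
    (hC : ∀ x y, 0 ≤ y → E (x, y) ∈ C) (hD : ∀ x y, y ≤ 0 → E (x, y) ∈ D)
    (hpar : ∀ ℓ ∈ A, (∃ c : ℝ, ∀ x y, E (x, y) ∈ ℓ ↔ y = c) → ℓ ⊆ D) :
    A.card ≤ mu A C * mu A D := by
  have hex : ∀ ℓ : Set (ℝ × ℝ), ∃ a w : ℝ,
      ℓ ∈ (A.filter fun ℓ => ¬ ∃ c : ℝ, ∀ x y, E (x, y) ∈ ℓ ↔ y = c) →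
      ∀ x y, E (x, y) ∈ ℓ ↔ x = a + y * w := by
    intro ℓ
    by_cases hℓ : ℓ ∈ (A.filter fun ℓ => ¬ ∃ c : ℝ, ∀ x y, E (x, y) ∈ ℓ ↔ y = c)
    · have h := Finset.mem_filter.1 hℓ
      obtain ⟨α, β, γ, hab, h'⟩ := hA ℓ h.1
      have hα : α ≠ 0 := by
        rintro rfl
        have hβ : β ≠ 0 := by
          rintro rfl
          exact hab rfl
        refine h.2 ⟨γ / β, fun x y => ?_⟩
        rw [h', eq_div_iff hβ]
        constructor <;> intro h0 <;> linarith
      refine ⟨γ / α, -β / α, fun _ x y => ?_⟩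
      rw [h']
      field_simp
      constructor <;> intro h0 <;> linarith
    · exact ⟨0, 0, fun h => absurd h hℓ⟩
  choose a w haw using hex
  have hmeet : ∀ ℓ ∈ (A.filter fun ℓ => ¬ ∃ c : ℝ, ∀ x y, E (x, y) ∈ ℓ ↔ y = c),
      ∀ ℓ' ∈ (A.filter fun ℓ => ¬ ∃ c : ℝ, ∀ x y, E (x, y) ∈ ℓ ↔ y = c),
      ℓ ≠ ℓ' → ∀ x y, E (x, y) ∈ ℓ → E (x, y) ∈ ℓ' →
      w ℓ ≠ w ℓ' ∧ y * (w ℓ - w ℓ') = a ℓ' - a ℓ := by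
    intro ℓ hℓ ℓ' hℓ' hne x y hq hq'
    rw [haw ℓ hℓ] at hq
    rw [haw ℓ' hℓ'] at hq'
    refine ⟨fun hw => hne (ext_coord (E := E) fun u v => ?_), by linarith⟩
    rw [haw ℓ hℓ, haw ℓ' hℓ', hw, show a ℓ = a ℓ' by rw [hw] at hq; linarith]
  rw [← Finset.card_filter_add_card_filter_not (s := A)
    (fun ℓ => ∃ c : ℝ, ∀ x y, E (x, y) ∈ ℓ ↔ y = c), add_comm]
  refine card_add_card_le_mu_mul_mu (Finset.filter_subset _ _) (Finset.filter_subset _ _)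
    (Finset.disjoint_filter_filter_not _ _ _).symm a w ?_ ?_
    (fun ℓ hℓ => hpar ℓ (Finset.mem_filter.1 hℓ).1 (Finset.mem_filter.1 hℓ).2)
  · rintro ℓ hℓ ℓ' hℓ' hne ha hw q ⟨hq, hq'⟩
    obtain ⟨⟨x, y⟩, rfl⟩ := E.surjective q
    obtain ⟨hww, hy⟩ := hmeet ℓ hℓ ℓ' hℓ' hne x y hq hq'
    have := lt_of_le_of_ne hw hww
    refine hD x y ?_
    by_contra! hy0
    nlinarith
  · rintro ℓ hℓ ℓ' hℓ' hne ha hw q ⟨hq, hq'⟩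
    obtain ⟨⟨x, y⟩, rfl⟩ := E.surjective q
    obtain ⟨hww, hy⟩ := hmeet ℓ hℓ ℓ' hℓ' hne x y hq hq'
    have := lt_of_le_of_ne hw hww.symm
    refine hC x y ?_
    by_contra! hy0
    nlinarith

end Quadrant

/-- If the frontier of `C₁` misses two preconnected sets with dense union, then the two closed
regions contain the closures of these sets, one each. -/
lemma closure_subset_of_disjoint_frontier {X : Type*} [TopologicalSpace X] {C₁ C₂ S T : Set X}
    (hC₁ : IsClosed C₁) (hC₂ : IsClosed C₂) (hunion : C₁ ∪ C₂ = Set.univ)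
    (h₁ : C₁ ≠ Set.univ) (h₂ : C₂ ≠ Set.univ) (hS : IsPreconnected S) (hT : IsPreconnected T)
    (hSf : Disjoint S (frontier C₁)) (hTf : Disjoint T (frontier C₁))
    (hST : closure (S ∪ T) = Set.univ) :
    (closure S ⊆ C₁ ∧ closure T ⊆ C₂) ∨ (closure S ⊆ C₂ ∧ closure T ⊆ C₁) := by
  have key : ∀ P : Set X, IsPreconnected P → Disjoint P (frontier C₁) →
      closure P ⊆ C₁ ∨ closure P ⊆ C₂ := by
    intro P hP hPf
    have hcompl : C₁ᶜ ⊆ C₂ := Set.compl_subset_iff_union.2 hunion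
    have hcover : P ⊆ interior C₁ ∪ C₁ᶜ := by
      intro x hx
      by_cases hx₁ : x ∈ C₁
      · refine Or.inl ?_
        by_contra hxi
        refine Set.disjoint_left.1 hPf hx ?_
        rw [hC₁.frontier_eq]
        exact ⟨hx₁, hxi⟩
      · exact Or.inr hx₁
    rcases IsPreconnected.subset_or_subset isOpen_interior hC₁.isOpen_compl
      (disjoint_compl_right.mono_left interior_subset) hcover hP with h | h
    · exact Or.inl (closure_minimal (h.trans interior_subset) hC₁)
    · exact Or.inr (closure_minimal (h.trans hcompl) hC₂)
  rw [closure_union] at hST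
  rcases key S hS hSf with hS' | hS' <;> rcases key T hT hTf with hT' | hT'
  · exact absurd (Set.univ_subset_iff.1 (hST ▸ Set.union_subset hS' hT')) h₁
  · exact Or.inl ⟨hS', hT'⟩
  · exact Or.inr ⟨hS', hT'⟩
  · exact absurd (Set.univ_subset_iff.1 (hST ▸ Set.union_subset hS' hT')) h₂

/-- The affine frame with origin `p` and basis `v`, `w`. -/
noncomputable def frame (p v w : ℝ × ℝ) (h : v.1 * w.2 - v.2 * w.1 ≠ 0) :
    ℝ × ℝ ≃ₜ ℝ × ℝ where
  toFun q := p + q.1 • v + q.2 • w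
  invFun q :=
    (((q.1 - p.1) * w.2 - (q.2 - p.2) * w.1) / (v.1 * w.2 - v.2 * w.1),
      (v.1 * (q.2 - p.2) - v.2 * (q.1 - p.1)) / (v.1 * w.2 - v.2 * w.1))
  left_inv q := by
    ext
    · simp only [Prod.fst_add, Prod.snd_add, Prod.smul_fst, Prod.smul_snd, smul_eq_mul]
      rw [div_eq_iff h]; ring
    · simp only [Prod.fst_add, Prod.snd_add, Prod.smul_fst, Prod.smul_snd, smul_eq_mul]
      rw [div_eq_iff h]; ring
  right_inv q := by
    ext
    · simp only [Prod.fst_add, Prod.smul_fst, smul_eq_mul]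
      rw [div_mul_eq_mul_div, div_mul_eq_mul_div, add_assoc, ← add_div,
        ← eq_sub_iff_add_eq', div_eq_iff h]
      ring
    · simp only [Prod.snd_add, Prod.smul_snd, smul_eq_mul]
      rw [div_mul_eq_mul_div, div_mul_eq_mul_div, add_assoc, ← add_div,
        ← eq_sub_iff_add_eq', div_eq_iff h]
      ring
  continuous_toFun := by fun_prop
  continuous_invFun := by fun_prop

lemma frame_apply {p v w : ℝ × ℝ} (h : v.1 * w.2 - v.2 * w.1 ≠ 0) (q : ℝ × ℝ) :
    frame p v w h q = p + q.1 • v + q.2 • w := rfl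

lemma IsLine.isLineIn_frame {p v w : ℝ × ℝ} (h : v.1 * w.2 - v.2 * w.1 ≠ 0)
    {ℓ : Set (ℝ × ℝ)} (hℓ : IsLine ℓ) : IsLineIn (frame p v w h).toEquiv ℓ := by
  obtain ⟨a, b, c, hab, rfl⟩ := hℓ
  refine ⟨a * v.1 + b * v.2, a * w.1 + b * w.2, c - a * p.1 - b * p.2, ?_, fun x y => ?_⟩
  · intro h0
    simp only [Prod.mk.injEq] at h0
    refine hab ?_
    have ha : a * (v.1 * w.2 - v.2 * w.1) = 0 := by
      linear_combination w.2 * h0.1 - v.2 * h0.2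
    have hb : b * (v.1 * w.2 - v.2 * w.1) = 0 := by
      linear_combination v.1 * h0.2 - w.1 * h0.1
    rw [(mul_eq_zero.1 ha).resolve_right h, (mul_eq_zero.1 hb).resolve_right h]
  · change a * (p + x • v + y • w).1 + b * (p + x • v + y • w).2 = c ↔ _
    simp only [Prod.fst_add, Prod.snd_add, Prod.smul_fst, Prod.smul_snd, smul_eq_mul]
    constructor <;> intro h0 <;> linarith

lemma frame_mem_ray_smul {p v w : ℝ × ℝ} (h : v.1 * w.2 - v.2 * w.1 ≠ 0) (c x y : ℝ) :
    frame p v w h (x, y) ∈ ray p (c • v) ↔ (∃ t : ℝ, 0 ≤ t ∧ x = t * c) ∧ y = 0 := by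
  have key : ∀ t : ℝ, frame p v w h (x, y) = p + t • c • v ↔ x = t * c ∧ y = 0 := by
    intro t
    rw [show p + t • c • v = frame p v w h (t * c, 0) by simp [frame_apply, mul_smul],
      (frame p v w h).injective.eq_iff, Prod.mk.injEq]
  simp only [ray, Set.mem_ofPred_eq, key]
  constructor
  · rintro ⟨t, ht, hx, hy⟩
    exact ⟨⟨t, ht, hx⟩, hy⟩
  · rintro ⟨⟨t, ht, hx⟩, hy⟩
    exact ⟨t, ht, hx, hy⟩

lemma frame_mem_ray_left {p v w : ℝ × ℝ} (h : v.1 * w.2 - v.2 * w.1 ≠ 0) (x y : ℝ) :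
    frame p v w h (x, y) ∈ ray p v ↔ 0 ≤ x ∧ y = 0 := by
  simpa using frame_mem_ray_smul (p := p) h 1 x y

lemma frame_mem_ray_right {p v w : ℝ × ℝ} (h : v.1 * w.2 - v.2 * w.1 ≠ 0) (x y : ℝ) :
    frame p v w h (x, y) ∈ ray p w ↔ 0 ≤ y ∧ x = 0 := by
  have key : ∀ t : ℝ, frame p v w h (x, y) = p + t • w ↔ x = 0 ∧ y = t := by
    intro t
    rw [show p + t • w = frame p v w h (0, t) by simp [frame_apply],
      (frame p v w h).injective.eq_iff, Prod.mk.injEq]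
  simp only [ray, Set.mem_ofPred_eq, key]
  constructor
  · rintro ⟨t, ht, hx, rfl⟩
    exact ⟨ht, hx⟩
  · rintro ⟨hy, hx⟩
    exact ⟨y, hy, hx, rfl⟩

/-- The bound when the regions are the half-planes bounded by an axis and no two lines are
parallel. -/
lemma card_le_of_halfPlane_of_pairwiseNonParallel {E : ℝ × ℝ ≃ ℝ × ℝ}
    {A : Finset (Set (ℝ × ℝ))} {C D : Set (ℝ × ℝ)} (hA : ∀ ℓ ∈ A, IsLineIn E ℓ)
    (hpw : PairwiseNonParallel A) (hC : ∀ x y, 0 ≤ y → E (x, y) ∈ C)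
    (hD : ∀ x y, y ≤ 0 → E (x, y) ∈ D) :
    A.card ≤ mu A C * mu A D := by
  by_cases hpar : ∀ ℓ ∈ A, (∃ c : ℝ, ∀ x y, E (x, y) ∈ ℓ ↔ y = c) → ℓ ⊆ D
  · exact card_le_of_halfPlane hA hC hD hpar
  push Not at hpar
  obtain ⟨ℓ₀, hℓ₀, ⟨c₀, hc₀⟩, hsub⟩ := hpar
  have hpos : 0 < c₀ := by
    by_contra! hle
    refine hsub fun q hq => ?_
    obtain ⟨⟨x, y⟩, rfl⟩ := E.surjective q
    exact hD x y (((hc₀ x y).1 hq).trans_le hle)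
  set E' : ℝ × ℝ ≃ ℝ × ℝ := (Equiv.prodCongr (Equiv.refl ℝ) (Equiv.neg ℝ)).trans E
  have hE' : ∀ x y, E' (x, y) = E (x, -y) := fun _ _ => rfl
  rw [mul_comm]
  refine card_le_of_halfPlane (E := E') (fun ℓ hℓ => ?_) (fun x y hy => ?_) (fun x y hy => ?_)
    (fun ℓ hℓ ⟨c, hc⟩ => ?_)
  · obtain ⟨a, b, c, hab, h⟩ := hA ℓ hℓ
    refine ⟨a, -b, c, by simpa using hab, fun x y => ?_⟩
    rw [hE', h, mul_neg, neg_mul]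
  · rw [hE']; exact hD _ _ (by linarith)
  · rw [hE']; exact hC _ _ (by linarith)
  · have hmem : ∀ x y, E (x, y) ∈ ℓ ↔ y = -c := by
      intro x y
      have := hc x (-y)
      rw [hE', neg_neg] at this
      rw [this, neg_eq_iff_eq_neg]
    have hcc : -c = c₀ := by
      by_cases hne : ℓ = ℓ₀
      · subst hne
        exact (hc₀ 0 (-c)).1 ((hmem 0 (-c)).2 rfl)
      · obtain ⟨q, ⟨hq, hq₀⟩, -⟩ := hpw ℓ hℓ ℓ₀ hℓ₀ hne
        obtain ⟨⟨x, y⟩, rfl⟩ := E.surjective q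
        rw [← (hmem x y).1 hq, (hc₀ x y).1 hq₀]
    intro q hq
    obtain ⟨⟨x, y⟩, rfl⟩ := E.surjective q
    exact hC x y (by rw [(hmem x y).1 hq, hcc]; exact hpos.le)

lemma closure_openQuadrant_union :
    closure ((Set.Ioi (0 : ℝ) ×ˢ Set.Ioi (0 : ℝ)) ∪
      (Set.Iio (0 : ℝ) ×ˢ Set.univ ∪ Set.univ ×ˢ Set.Iio (0 : ℝ))) = Set.univ := by
  simp only [closure_union, closure_prod_eq, closure_Ioi, closure_Iio, closure_univ]
  ext ⟨x, y⟩
  simp only [Set.mem_union, Set.mem_prod, Set.mem_Ici, Set.mem_Iic, Set.mem_univ, and_true,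
    true_and, iff_true]
  rcases le_total 0 x with hx | hx <;> rcases le_total 0 y with hy | hy <;> simp [*]

lemma isPreconnected_compl_closedQuadrant :
    IsPreconnected (Set.Iio (0 : ℝ) ×ˢ Set.univ ∪ Set.univ ×ˢ Set.Iio (0 : ℝ)) :=
  IsPreconnected.union (-1, -1) (by simp) (by simp)
    (isPreconnected_Iio.prod isPreconnected_univ) (isPreconnected_univ.prod isPreconnected_Iio)

/-- **Lemma (broken line).** Let `A` be a set of `n` lines in general position, and let two
rays `r₁`, `r₂` from a common point `p` split the plane into two closed regions `C₁`, `C₂`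
(covering the plane, with disjoint interiors and common boundary `r₁ ∪ r₂`).  Then
`μ_A(C₁)·μ_A(C₂) ≥ 2n/3`. -/
theorem broken_line_lemma (n : ℕ) (A : Finset (Set (ℝ × ℝ)))
    (hlines : ∀ ℓ ∈ A, IsLine ℓ) (hcard : A.card = n) (hgp : GenPos A)
    (p v₁ v₂ : ℝ × ℝ) (hv₁ : v₁ ≠ 0) (hv₂ : v₂ ≠ 0)
    (C₁ C₂ : Set (ℝ × ℝ)) (hC₁ : IsClosed C₁) (hC₂ : IsClosed C₂)
    (hunion : C₁ ∪ C₂ = Set.univ)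
    (hint : interior C₁ ∩ interior C₂ = ∅)
    (hbd₁ : frontier C₁ = ray p v₁ ∪ ray p v₂)
    (hbd₂ : frontier C₂ = ray p v₁ ∪ ray p v₂) :
    (2 * n : ℝ) / 3 ≤ (mu A C₁ : ℝ) * (mu A C₂ : ℝ) := by
  have hray : p ∈ ray p v₁ ∪ ray p v₂ := Or.inl ⟨0, le_rfl, by simp⟩
  have hne₁ : C₁ ≠ Set.univ := by
    rintro rfl
    rw [← hbd₁, frontier_univ] at hray
    exact hray
  have hne₂ : C₂ ≠ Set.univ := by
    rintro rfl
    rw [← hbd₂, frontier_univ] at hray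
    exact hray
  -- The regions in the coordinates of a frame at `p`.
  have hsplit : ∀ (v w : ℝ × ℝ) (h : v.1 * w.2 - v.2 * w.1 ≠ 0) (S T : Set (ℝ × ℝ)),
      IsPreconnected S → IsPreconnected T → closure (S ∪ T) = Set.univ →
      (∀ q ∈ S ∪ T, frame p v w h q ∉ ray p v₁ ∪ ray p v₂) →
      (closure S ⊆ frame p v w h ⁻¹' C₁ ∧ closure T ⊆ frame p v w h ⁻¹' C₂) ∨
      (closure S ⊆ frame p v w h ⁻¹' C₂ ∧ closure T ⊆ frame p v w h ⁻¹' C₁) := by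
    intro v w h S T hS hT hST hdisj
    have hpre : ∀ C : Set (ℝ × ℝ), C ≠ Set.univ → frame p v w h ⁻¹' C ≠ Set.univ := by
      intro C hC h0
      rw [Set.preimage_eq_univ_iff, (frame p v w h).surjective.range_eq, Set.univ_subset_iff] at h0
      exact hC h0
    refine closure_subset_of_disjoint_frontier (hC₁.preimage (frame p v w h).continuous)
      (hC₂.preimage (frame p v w h).continuous) ?_ (hpre C₁ hne₁) (hpre C₂ hne₂) hS hT ?_ ?_ hST
    · rw [← Set.preimage_union, hunion, Set.preimage_univ]
    · rw [← Homeomorph.preimage_frontier, hbd₁, Set.disjoint_left]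
      exact fun q hq => hdisj q (Or.inl hq)
    · rw [← Homeomorph.preimage_frontier, hbd₁, Set.disjoint_left]
      exact fun q hq => hdisj q (Or.inr hq)
  suffices hmain : 2 * n ≤ 3 * (mu A C₁ * mu A C₂) by
    have hmain' : (2 * n : ℝ) ≤ 3 * ((mu A C₁ : ℝ) * (mu A C₂ : ℝ)) := by exact_mod_cast hmain
    linarith
  subst hcard
  by_cases hdet : v₁.1 * v₂.2 - v₁.2 * v₂.1 = 0
  · have hnorm : v₁.1 * v₁.1 - v₁.2 * (-v₁.2) ≠ 0 := by
      intro h0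
      have h1 : v₁.1 = 0 := by nlinarith [mul_self_nonneg v₁.1, mul_self_nonneg v₁.2]
      have h2 : v₁.2 = 0 := by nlinarith [mul_self_nonneg v₁.1, mul_self_nonneg v₁.2]
      exact hv₁ (Prod.ext h1 h2)
    obtain ⟨c, rfl⟩ : ∃ c : ℝ, v₂ = c • v₁ := by
      refine ⟨(v₁.1 * v₂.1 + v₁.2 * v₂.2) / (v₁.1 * v₁.1 - v₁.2 * (-v₁.2)), ?_⟩
      ext
      · simp only [Prod.smul_fst, smul_eq_mul]
        rw [div_mul_eq_mul_div, eq_div_iff hnorm]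
        linear_combination (-v₁.2) * hdet
      · simp only [Prod.smul_snd, smul_eq_mul]
        rw [div_mul_eq_mul_div, eq_div_iff hnorm]
        linear_combination v₁.1 * hdet
    have hc : c ≠ 0 := by
      rintro rfl
      exact hv₂ (zero_smul _ _)
    have hE := hsplit v₁ (-v₁.2, v₁.1) hnorm
    rcases hc.lt_or_gt with hc | hc
    · have hcard : A.card ≤ mu A C₁ * mu A C₂ := by
        have hlin := fun ℓ hℓ =>
          (hlines ℓ hℓ).isLineIn_frame (p := p) (v := v₁) (w := (-v₁.2, v₁.1)) hnorm
        have := hE (Set.univ ×ˢ Set.Ioi 0) (Set.univ ×ˢ Set.Iio 0)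
          (isPreconnected_univ.prod isPreconnected_Ioi)
          (isPreconnected_univ.prod isPreconnected_Iio)
          (by
            simp only [closure_union, closure_prod_eq, closure_Ioi, closure_Iio, closure_univ,
              ← Set.prod_union]
            rw [Set.union_comm, Set.Iic_union_Ici, Set.univ_prod_univ])
          (by
            rintro ⟨x, y⟩ hq (h0 | h0)
            · rw [frame_mem_ray_left] at h0
              simp [h0.2] at hq
            · rw [frame_mem_ray_smul] at h0
              simp [h0.2] at hq)
        simp only [closure_prod_eq, closure_Ioi, closure_Iio, closure_univ] at this
        rcases this with ⟨h1, h2⟩ | ⟨h1, h2⟩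
        · exact card_le_of_halfPlane_of_pairwiseNonParallel hlin hgp.1
            (fun x y hy => h1 (show (x, y) ∈ _ from ⟨trivial, hy⟩))
            (fun x y hy => h2 (show (x, y) ∈ _ from ⟨trivial, hy⟩))
        · rw [mul_comm]
          exact card_le_of_halfPlane_of_pairwiseNonParallel hlin hgp.1
            (fun x y hy => h1 (show (x, y) ∈ _ from ⟨trivial, hy⟩))
            (fun x y hy => h2 (show (x, y) ∈ _ from ⟨trivial, hy⟩))
      omega
    · exfalso
      -- The complement of a ray is connected and dense.
      set S : Set (ℝ × ℝ) := (Set.univ ×ˢ Set.Ioi 0 ∪ Set.Iio 0 ×ˢ Set.univ) ∪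
        (Set.Iio 0 ×ˢ Set.univ ∪ Set.univ ×ˢ Set.Iio 0) with hSdef
      have hS : IsPreconnected S :=
        IsPreconnected.union (-1, -1) (by simp) (by simp)
          (IsPreconnected.union (-1, 1) (by simp) (by simp)
            (isPreconnected_univ.prod isPreconnected_Ioi)
            (isPreconnected_Iio.prod isPreconnected_univ))
          isPreconnected_compl_closedQuadrant
      have hdense : closure S = Set.univ := by
        refine Set.univ_subset_iff.1 (closure_openQuadrant_union.symm.subset.trans ?_)
        refine closure_mono (Set.union_subset_union_left _ ?_)
        exact (Set.prod_mono_left (Set.subset_univ _)).trans Set.subset_union_left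
      have := hE S S hS hS (by rw [Set.union_self, hdense]) (by
        rintro ⟨x, y⟩ hq h0
        have h1 : 0 ≤ x ∧ y = 0 := by
          rcases h0 with h0 | h0
          · rwa [frame_mem_ray_left] at h0
          · rw [frame_mem_ray_smul] at h0
            obtain ⟨⟨t, ht, rfl⟩, hy⟩ := h0
            exact ⟨by positivity, hy⟩
        simp [hSdef, h1.2, not_lt.2 h1.1] at hq)
      rw [hdense] at this
      have h1 : Set.univ ⊆ frame p v₁ (-v₁.2, v₁.1) hnorm ⁻¹' C₁ := by
        rcases this with h | h
        · exact h.1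
        · exact h.2
      refine hne₁ (Set.eq_univ_of_forall fun q => ?_)
      obtain ⟨q, rfl⟩ := (frame p v₁ (-v₁.2, v₁.1) hnorm).surjective q
      exact h1 trivial
  · have hlin := fun ℓ hℓ => (hlines ℓ hℓ).isLineIn_frame (p := p) hdet
    have := hsplit v₁ v₂ hdet _ _ (isPreconnected_Ioi.prod isPreconnected_Ioi)
      isPreconnected_compl_closedQuadrant closure_openQuadrant_union (by
        rintro ⟨x, y⟩ hq (h0 | h0)
        · rw [frame_mem_ray_left] at h0
          simp [h0.2, not_lt.2 h0.1] at hq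
        · rw [frame_mem_ray_right] at h0
          simp [h0.2, not_lt.2 h0.1] at hq)
    simp only [closure_union, closure_prod_eq, closure_Ioi, closure_Iio, closure_univ] at this
    have hout : ∀ x y : ℝ, x ≤ 0 ∨ y ≤ 0 →
        (x, y) ∈ Set.Iic (0 : ℝ) ×ˢ Set.univ ∪ Set.univ ×ˢ Set.Iic (0 : ℝ) := by
      intro x y h
      simpa using h
    rcases this with ⟨h1, h2⟩ | ⟨h1, h2⟩
    · exact two_mul_card_le_of_quadrant hlin
        (fun x y hx hy => h1 (show (x, y) ∈ _ from ⟨hx, hy⟩)) (fun x y h => h2 (hout x y h))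
    · rw [mul_comm (mu A C₁)]
      exact two_mul_card_le_of_quadrant hlin
        (fun x y hx hy => h1 (show (x, y) ∈ _ from ⟨hx, hy⟩)) (fun x y h => h2 (hout x y h))
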